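/- arXiv:0908.2604 — 2 statements merged into one kernel-verified Lean document; each statement's English description precedes it below -/
import Mathlib

section
/- The F-algebra e*_0 T e*_0 (with multiplicative identity e*_0) is commutative and is generated by the elements e*_0 τ_i(a) e*_0 for 1 ≤ i ≤ d; consequently there exists a surjective F-algebra homomorphism μ : F[x_1,…,x_d] → e*_0 T e*_0 that sends x_i ↦ e*_0 τ_i(a) e*_0 for 1 ≤ i ≤ d, where F[x_1,…,x_d] is the polynomial algebra over F in d mutually commuting indeterminates. -/
open Polynomial

noncomputable section

/-- The polynomial `τ_i = (λ−θ_0)(λ−θ_1)⋯(λ−θ_{i−1})`. -/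
def tauPoly {F : Type*} [Field F] (θ : ℕ → F) (i : ℕ) : Polynomial F :=
  ∏ j ∈ Finset.range i, (X - C (θ j))

/-- The polynomial `η_i = (λ−θ_d)(λ−θ_{d−1})⋯(λ−θ_{d−i+1})`. -/
def etaPoly {F : Type*} [Field F] (d : ℕ) (θ : ℕ → F) (i : ℕ) : Polynomial F :=
  ∏ j ∈ Finset.range i, (X - C (θ (d - j)))

/-- Generators of the algebra `T`: `a`, `a*`, `e_0,…,e_d`, `e*_0,…,e*_d`. -/
inductive TGen (d : ℕ) : Type
  | a : TGen d
  | astar : TGen d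
  | e : Fin (d + 1) → TGen d
  | estar : Fin (d + 1) → TGen d

/-- The defining relations of the algebra `T`. -/
inductive TRel (F : Type*) [Field F] (d : ℕ) (θ θs : ℕ → F) :
    FreeAlgebra F (TGen d) → FreeAlgebra F (TGen d) → Prop
  | ee (i j : Fin (d + 1)) :
      TRel F d θ θs (FreeAlgebra.ι F (TGen.e i) * FreeAlgebra.ι F (TGen.e j))
        (if i = j then FreeAlgebra.ι F (TGen.e i) else 0)
  | eses (i j : Fin (d + 1)) :
      TRel F d θ θs (FreeAlgebra.ι F (TGen.estar i) * FreeAlgebra.ι F (TGen.estar j))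
        (if i = j then FreeAlgebra.ι F (TGen.estar i) else 0)
  | sum_e : TRel F d θ θs (∑ i : Fin (d + 1), FreeAlgebra.ι F (TGen.e i)) 1
  | sum_estar : TRel F d θ θs (∑ i : Fin (d + 1), FreeAlgebra.ι F (TGen.estar i)) 1
  | a_eq : TRel F d θ θs (FreeAlgebra.ι F TGen.a)
      (∑ i : Fin (d + 1), θ (i : ℕ) • FreeAlgebra.ι F (TGen.e i))
  | astar_eq : TRel F d θ θs (FreeAlgebra.ι F TGen.astar)
      (∑ i : Fin (d + 1), θs (i : ℕ) • FreeAlgebra.ι F (TGen.estar i))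
  | trid (i j : Fin (d + 1)) (k : ℕ) (hk : k ≤ d)
      (h : k < max ((i : ℕ) - (j : ℕ)) ((j : ℕ) - (i : ℕ))) :
      TRel F d θ θs (FreeAlgebra.ι F (TGen.estar i) * FreeAlgebra.ι F TGen.a ^ k *
        FreeAlgebra.ι F (TGen.estar j)) 0
  | tridstar (i j : Fin (d + 1)) (k : ℕ) (hk : k ≤ d)
      (h : k < max ((i : ℕ) - (j : ℕ)) ((j : ℕ) - (i : ℕ))) :
      TRel F d θ θs (FreeAlgebra.ι F (TGen.e i) * FreeAlgebra.ι F TGen.astar ^ k *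
        FreeAlgebra.ι F (TGen.e j)) 0

/-- The `F`-algebra `T` presented by the above generators and relations. -/
abbrev TAlg (F : Type*) [Field F] (d : ℕ) (θ θs : ℕ → F) : Type _ :=
  RingQuot (TRel F d θ θs)

/-- The image in `T` of a generator. -/
def tgen (F : Type*) [Field F] (d : ℕ) (θ θs : ℕ → F) (g : TGen d) : TAlg F d θ θs :=
  RingQuot.mkAlgHom F (TRel F d θ θs) (FreeAlgebra.ι F g)

/-- The element `a` of `T`. -/
def aT (F : Type*) [Field F] (d : ℕ) (θ θs : ℕ → F) : TAlg F d θ θs :=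
  tgen F d θ θs TGen.a

/-- The element `a*` of `T`. -/
def asT (F : Type*) [Field F] (d : ℕ) (θ θs : ℕ → F) : TAlg F d θ θs :=
  tgen F d θ θs TGen.astar

/-- The element `e_i` of `T` (defined to be `0` for `i > d`). -/
def eT (F : Type*) [Field F] (d : ℕ) (θ θs : ℕ → F) (i : ℕ) : TAlg F d θ θs :=
  if h : i < d + 1 then tgen F d θ θs (TGen.e ⟨i, h⟩) else 0

/-- The element `e*_i` of `T` (defined to be `0` for `i > d`). -/
def esT (F : Type*) [Field F] (d : ℕ) (θ θs : ℕ → F) (i : ℕ) : TAlg F d θ θs :=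
  if h : i < d + 1 then tgen F d θ θs (TGen.estar ⟨i, h⟩) else 0

/-- Conditions (i) and (iii): the `θ_i` are mutually distinct, the `θ*_i` are mutually
distinct, and the expressions `(θ_{i-2}−θ_{i+1})/(θ_{i-1}−θ_i)`,
`(θ*_{i-2}−θ*_{i+1})/(θ*_{i-1}−θ*_i)` are equal and independent of `i` for `2 ≤ i ≤ d−1`. -/
def EigCond (F : Type*) [Field F] (d : ℕ) (θ θs : ℕ → F) : Prop :=
  (∀ i j, i ≤ d → j ≤ d → i ≠ j → θ i ≠ θ j) ∧
  (∀ i j, i ≤ d → j ≤ d → i ≠ j → θs i ≠ θs j) ∧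
  ∃ β : F, ∀ i, 2 ≤ i → i + 1 ≤ d →
    θ (i - 2) - θ (i + 1) = β * (θ (i - 1) - θ i) ∧
    θs (i - 2) - θs (i + 1) = β * (θs (i - 1) - θs i)

/-- The subalgebra `D` of `T` generated by `a`, as an `F`-subspace. -/
def Dsub (F : Type*) [Field F] (d : ℕ) (θ θs : ℕ → F) : Submodule F (TAlg F d θ θs) :=
  Subalgebra.toSubmodule (Algebra.adjoin F {aT F d θ θs})

/-- The subalgebra `D*` of `T` generated by `a*`, as an `F`-subspace. -/
def DsSub (F : Type*) [Field F] (d : ℕ) (θ θs : ℕ → F) : Submodule F (TAlg F d θ θs) :=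
  Subalgebra.toSubmodule (Algebra.adjoin F {asT F d θ θs})

end

noncomputable section

/-- A tridiagonal system on `V` of diameter `d`, with data `(A; {E_i}; A*; {E*_i})`,
eigenvalue sequence `θ` and dual eigenvalue sequence `θs`.  The families `E`, `Es` are the
orderings of the primitive idempotents of `A`, `A*` (so the `E_i V` are the eigenspaces of the
diagonalizable map `A`, ordered so that the tridiagonal conditions hold, and similarly for
`A*`), and the last condition is the irreducibility condition (iv). -/
def IsTDSystem (F : Type*) [Field F] (V : Type*) [AddCommGroup V] [Module F V]
    (d : ℕ) (A As : V →ₗ[F] V) (E Es : ℕ → (V →ₗ[F] V)) (θ θs : ℕ → F) : Prop :=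
  FiniteDimensional F V ∧ 0 < Module.finrank F V ∧
  (∀ i j, i ≤ d → j ≤ d → i ≠ j → θ i ≠ θ j) ∧
  (∀ i j, i ≤ d → j ≤ d → i ≠ j → θs i ≠ θs j) ∧
  (∀ i, i ≤ d → E i ≠ 0) ∧
  (∀ i, i ≤ d → Es i ≠ 0) ∧
  (∀ i j, i ≤ d → j ≤ d → E i ∘ₗ E j = if i = j then E i else 0) ∧
  (∀ i j, i ≤ d → j ≤ d → Es i ∘ₗ Es j = if i = j then Es i else 0) ∧
  (∑ i ∈ Finset.range (d + 1), E i) = LinearMap.id ∧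
  (∑ i ∈ Finset.range (d + 1), Es i) = LinearMap.id ∧
  A = ∑ i ∈ Finset.range (d + 1), θ i • E i ∧
  As = ∑ i ∈ Finset.range (d + 1), θs i • Es i ∧
  (∀ i, i ≤ d → Submodule.map As (LinearMap.range (E i)) ≤
    (if i = 0 then ⊥ else LinearMap.range (E (i - 1))) ⊔ LinearMap.range (E i) ⊔
      (if i = d then ⊥ else LinearMap.range (E (i + 1)))) ∧
  (∀ i, i ≤ d → Submodule.map A (LinearMap.range (Es i)) ≤
    (if i = 0 then ⊥ else LinearMap.range (Es (i - 1))) ⊔ LinearMap.range (Es i) ⊔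
      (if i = d then ⊥ else LinearMap.range (Es (i + 1)))) ∧
  (∀ W : Submodule F V, (∀ w ∈ W, A w ∈ W) → (∀ w ∈ W, As w ∈ W) → W = ⊥ ∨ W = ⊤)

/-- A sharp tridiagonal system with parameter array `(θ; θs; ζ)`:  a tridiagonal system
which is sharp (`dim E*_0 V = 1`) and whose split sequence is `ζ`, i.e.
`E*_0 τ_i(A) E*_0 = ζ_i E*_0 / ((θ*_0−θ*_1)⋯(θ*_0−θ*_i))` for `0 ≤ i ≤ d`. -/
def SharpTDWithArray (F : Type*) [Field F] (V : Type*) [AddCommGroup V] [Module F V]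
    (d : ℕ) (A As : V →ₗ[F] V) (E Es : ℕ → (V →ₗ[F] V)) (θ θs ζ : ℕ → F) : Prop :=
  IsTDSystem F V d A As E Es θ θs ∧
  Module.finrank F (LinearMap.range (Es 0)) = 1 ∧
  ∀ i, i ≤ d → Es 0 ∘ₗ (Polynomial.aeval A (tauPoly θ i)) ∘ₗ Es 0 =
    (ζ i / ∏ h ∈ Finset.Icc 1 i, (θs 0 - θs h)) • Es 0

/-- The action of an element `x` of `T` on a `T`-module `M`, as an `F`-linear map. -/
def actL {F : Type*} [Field F] {d : ℕ} {θ θs : ℕ → F} {M : Type*} [AddCommGroup M]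
    [Module F M] [Module (TAlg F d θ θs) M] [IsScalarTower F (TAlg F d θ θs) M]
    (x : TAlg F d θ θs) : M →ₗ[F] M where
  toFun m := x • m
  map_add' := smul_add x
  map_smul' c m := (smul_comm c x m).symm

/-- The `F`-linear map `T → M`, `t ↦ t • v`, for a vector `v` of a `T`-module `M`. -/
def applyVec {F : Type*} [Field F] {d : ℕ} {θ θs : ℕ → F} {M : Type*} [AddCommGroup M]
    [Module F M] [Module (TAlg F d θ θs) M] [IsScalarTower F (TAlg F d θ θs) M]
    (v : M) : TAlg F d θ θs →ₗ[F] M where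
  toFun t := t • v
  map_add' x y := add_smul x y v
  map_smul' c t := smul_assoc c t v

/-- The `F`-subspace `e*_0 T e*_0` of `T`. -/
def corner (F : Type*) [Field F] (d : ℕ) (θ θs : ℕ → F) : Submodule F (TAlg F d θ θs) :=
  LinearMap.range ((LinearMap.mulLeft F (esT F d θ θs 0)).comp
    (LinearMap.mulRight F (esT F d θ θs 0)))

/-- The properties characterizing the homomorphism `μ : F[x_1,…,x_d] → e*_0 T e*_0`:
it is `F`-linear, unital (with `1 ↦ e*_0`, the identity of `e*_0Te*_0`), multiplicative,
sends `x_i ↦ e*_0 τ_i(a) e*_0` for `1 ≤ i ≤ d`, and is onto `e*_0 T e*_0`. -/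
def MuProps (F : Type*) [Field F] (d : ℕ) (θ θs : ℕ → F)
    (μ : MvPolynomial (Fin d) F →ₗ[F] TAlg F d θ θs) : Prop :=
  μ 1 = esT F d θ θs 0 ∧
  (∀ p q, μ (p * q) = μ p * μ q) ∧
  (∀ i : Fin d, μ (MvPolynomial.X i) =
    esT F d θ θs 0 * (Polynomial.aeval (aT F d θ θs) (tauPoly θ ((i : ℕ) + 1))) *
      esT F d θ θs 0) ∧
  LinearMap.range μ = corner F d θ θs

/-- Conditions (ii) on the split sequence: `ζ_0 = 1`, `ζ_d ≠ 0` and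
`Σ_{i=0}^d η_{d−i}(θ_0) η*_{d−i}(θ*_0) ζ_i ≠ 0`. -/
def ZetaCond (F : Type*) [Field F] (d : ℕ) (θ θs : ℕ → F) (ζ : ℕ → F) : Prop :=
  ζ 0 = 1 ∧ ζ d ≠ 0 ∧
  (∑ i ∈ Finset.range (d + 1),
    (etaPoly d θ (d - i)).eval (θ 0) * (etaPoly d θs (d - i)).eval (θs 0) * ζ i) ≠ 0

/-- The element `g_i = e*_0 τ_i(a) e*_0 − ζ_i e*_0/((θ*_0−θ*_1)⋯(θ*_0−θ*_i))` of `T`. -/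
def gElt (F : Type*) [Field F] (d : ℕ) (θ θs : ℕ → F) (ζ : ℕ → F) (i : ℕ) :
    TAlg F d θ θs :=
  esT F d θ θs 0 * (Polynomial.aeval (aT F d θ θs) (tauPoly θ i)) * esT F d θ θs 0 -
    (ζ i / ∏ h ∈ Finset.Icc 1 i, (θs 0 - θs h)) • esT F d θ θs 0

/-- The left ideal `J = T(1−e*_0) + Σ_{i=1}^d T g_i` of `T`, as a submodule of `T` over
itself (with the left regular action). -/
def Jideal (F : Type*) [Field F] (d : ℕ) (θ θs : ℕ → F) (ζ : ℕ → F) :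
    Submodule (TAlg F d θ θs) (TAlg F d θ θs) :=
  Submodule.span (TAlg F d θ θs)
    ({1 - esT F d θ θs 0} ∪ (gElt F d θ θs ζ '' Set.Icc 1 d))

/-- The `F`-subspace `D D* D D* D ⋯ D D* D` of `T` with `n+1` factors `D`. -/
def DDchain (F : Type*) [Field F] (d : ℕ) (θ θs : ℕ → F) : ℕ → Submodule F (TAlg F d θ θs)
  | 0 => Dsub F d θ θs
  | n + 1 => DDchain F d θ θs n * DsSub F d θ θs * Dsub F d θ θs

/-- The `F`-subspace `e*_r D e*_{κ 1} D e*_{κ 2} ⋯ D e*_{κ m}` of `T`. -/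
def esChain (F : Type*) [Field F] (d : ℕ) (θ θs : ℕ → F) (r : ℕ) (κ : ℕ → ℕ) :
    ℕ → Submodule F (TAlg F d θ θs)
  | 0 => Submodule.span F {esT F d θ θs r}
  | m + 1 => esChain F d θ θs r κ m * Dsub F d θ θs *
      Submodule.span F {esT F d θ θs (κ (m + 1))}

/-- The sequence `(c_0, c_1, …, c_m)` is convex: `c_{i−1} − c_i ≥ c_i − c_{i+1}`
for `1 ≤ i ≤ m−1`. -/
def ConvexSeq (c : ℕ → ℤ) (m : ℕ) : Prop :=
  ∀ i, 1 ≤ i → i + 1 ≤ m → c i - c (i + 1) ≤ c (i - 1) - c i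

end

section Moments

variable {F : Type*} [Field F] {M : Type*} [AddCommGroup M] [Module F M]

/-- A function on nodes `θ_p` with finite support of size at most `n` vanishes if its first `n`
moments vanish. -/
theorem eq_zero_of_moments_of_card_le {θ : ℕ → F} {S : Finset ℕ}
    (hθ : Set.InjOn θ (S : Set ℕ)) {f : ℕ → M} {n : ℕ} (hn : S.card ≤ n)
    (hf : ∀ r < n, ∑ p ∈ S, θ p ^ r • f p = 0) {p : ℕ} (hp : p ∈ S) : f p = 0 := by
  have hpoly : ∀ P : Polynomial F, P.natDegree < n → ∑ q ∈ S, P.eval (θ q) • f q = 0 := by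
    intro P hP
    simp_rw [Polynomial.eval_eq_sum_range' hP, Finset.sum_smul, mul_smul]
    rw [Finset.sum_comm]
    refine Finset.sum_eq_zero fun r hr => ?_
    rw [← Finset.smul_sum, hf r (Finset.mem_range.1 hr), smul_zero]
  have hdeg : (Lagrange.basis S θ p).natDegree < n := by
    rw [Polynomial.natDegree_eq_of_degree_eq_some (Lagrange.degree_basis hθ hp)]
    have := Finset.card_pos.2 ⟨p, hp⟩
    omega
  have h := hpoly _ hdeg
  rw [Finset.sum_eq_single_of_mem p hp, Lagrange.eval_basis_self hθ hp, one_smul] at h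
  · exact h
  · intro q hq hqp
    rw [Lagrange.eval_basis_of_ne hqp.symm hq, zero_smul]

theorem eq_zero_of_moments {d : ℕ} {θ : ℕ → F}
    (hθ : ∀ i j, i ≤ d → j ≤ d → i ≠ j → θ i ≠ θ j) {f : ℕ → M} {n : ℕ}
    (hf : ∀ r < n, ∑ p ∈ Finset.range (d + 1), θ p ^ r • f p = 0) (S : Finset ℕ)
    (hS : S.card ≤ n) (hfS : ∀ p ≤ d, p ∉ S → f p = 0) {p : ℕ} (hp : p ≤ d) : f p = 0 := by
  by_cases hpS : p ∈ S
  · have hsub : S ∩ Finset.range (d + 1) ⊆ Finset.range (d + 1) := Finset.inter_subset_right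
    refine eq_zero_of_moments_of_card_le (S := S ∩ Finset.range (d + 1)) (n := n) (θ := θ)
      ?_ ((Finset.card_le_card Finset.inter_subset_left).trans hS) ?_ ?_
    · intro i hi j hj hij
      by_contra hne
      have hi' := Finset.mem_range.1 (hsub hi)
      have hj' := Finset.mem_range.1 (hsub hj)
      exact hθ i j (by omega) (by omega) hne hij
    · intro r hr
      rw [← hf r hr]
      refine Finset.sum_subset hsub fun q hq hq' => ?_
      have hqS : q ∉ S := fun h => hq' (Finset.mem_inter.2 ⟨h, hq⟩)
      rw [hfS q (by have := Finset.mem_range.1 hq; omega) hqS, smul_zero]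
    · exact Finset.mem_inter.2 ⟨hpS, Finset.mem_range.2 (by omega)⟩
  · exact hfS p hp hpS

/-- A banded array vanishes if its columns and rows have sufficiently many vanishing moments
compared with the width of the band. -/
theorem banded_eq_zero {d : ℕ} {θ : ℕ → F}
    (hθ : ∀ i j, i ≤ d → j ≤ d → i ≠ j → θ i ≠ θ j) {b : ℕ → ℕ → M} {N m n : ℕ}
    (hN : 2 * N ≤ m + n + 1)
    (hband : ∀ p q, p ≤ d → q ≤ d → p + N ≤ q ∨ q + N ≤ p → b p q = 0)
    (hcol : ∀ q ≤ d, ∀ r < m, ∑ p ∈ Finset.range (d + 1), θ p ^ r • b p q = 0)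
    (hrow : ∀ p ≤ d, ∀ r < n, ∑ q ∈ Finset.range (d + 1), θ q ^ r • b p q = 0)
    {p q : ℕ} (hp : p ≤ d) (hq : q ≤ d) : b p q = 0 := by
  have key : ∀ s, s ≤ d + 1 → ∃ A B, A + B = s ∧ ∀ p q, p ≤ d → q ≤ d →
      (p < A ∨ d < p + A ∨ q < B ∨ d < q + B) → b p q = 0 := by
    intro s
    induction s with
    | zero => exact fun _ => ⟨0, 0, rfl, fun p q _ _ h => by omega⟩
    | succ s ih =>
      intro hs
      obtain ⟨A, B, hAB, h0⟩ := ih (by omega)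
      by_cases hc : B + N ≤ m + A
      · refine ⟨A, B + 1, by omega, fun p q hp hq h => ?_⟩
        by_cases h' : p < A ∨ d < p + A ∨ q < B ∨ d < q + B
        · exact h0 p q hp hq h'
        · by_cases hqB : q = B
          · refine eq_zero_of_moments hθ (f := fun p => b p q) (hcol q hq)
              (Finset.Ico A (B + N)) (by simp; omega) (fun p' hp' hS => ?_) hp
            simp only [Finset.mem_Ico, not_and, not_lt] at hS
            by_cases hA : p' < A
            · exact h0 p' q hp' hq (Or.inl hA)
            · exact hband p' q hp' hq (by have := hS (by omega); omega)
          · refine eq_zero_of_moments hθ (f := fun p => b p q) (hcol q hq)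
              (Finset.Ico (d + 1 - (B + N)) (d + 1 - A)) (by simp; omega)
              (fun p' hp' hS => ?_) hp
            simp only [Finset.mem_Ico, not_and, not_lt] at hS
            by_cases hA : d < p' + A
            · exact h0 p' q hp' hq (Or.inr (Or.inl hA))
            · exact hband p' q hp' hq (by
                by_cases h2 : d + 1 - (B + N) ≤ p'
                · have := hS h2; omega
                · omega)
      · refine ⟨A + 1, B, by omega, fun p q hp hq h => ?_⟩
        by_cases h' : p < A ∨ d < p + A ∨ q < B ∨ d < q + B
        · exact h0 p q hp hq h'
        · by_cases hpA : p = A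
          · refine eq_zero_of_moments hθ (f := fun q => b p q) (hrow p hp)
              (Finset.Ico B (A + N)) (by simp; omega) (fun q' hq' hS => ?_) hq
            simp only [Finset.mem_Ico, not_and, not_lt] at hS
            by_cases hB : q' < B
            · exact h0 p q' hp hq' (by omega)
            · exact hband p q' hp hq' (by have := hS (by omega); omega)
          · refine eq_zero_of_moments hθ (f := fun q => b p q) (hrow p hp)
              (Finset.Ico (d + 1 - (A + N)) (d + 1 - B)) (by simp; omega)
              (fun q' hq' hS => ?_) hq
            simp only [Finset.mem_Ico, not_and, not_lt] at hS
            by_cases hB : d < q' + B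
            · exact h0 p q' hp hq' (by omega)
            · exact hband p q' hp hq' (by
                by_cases h2 : d + 1 - (A + N) ≤ q'
                · have := hS h2; omega
                · omega)
  obtain ⟨A, B, hAB, h0⟩ := key (d + 1) le_rfl
  exact h0 p q hp hq (by omega)

/-- Variant of `banded_eq_zero` for arrays with zero diagonal. -/
theorem banded_eq_zero_of_diag {d : ℕ} {θ : ℕ → F}
    (hθ : ∀ i j, i ≤ d → j ≤ d → i ≠ j → θ i ≠ θ j) {b : ℕ → ℕ → M} {n : ℕ}
    (hdiag : ∀ p ≤ d, b p p = 0)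
    (hband : ∀ p q, p ≤ d → q ≤ d → p + n < q ∨ q + n < p → b p q = 0)
    (hcol : ∀ q ≤ d, ∀ r < n, ∑ p ∈ Finset.range (d + 1), θ p ^ r • b p q = 0)
    (hrow : ∀ p ≤ d, ∀ r < n, ∑ q ∈ Finset.range (d + 1), θ q ^ r • b p q = 0)
    {p q : ℕ} (hp : p ≤ d) (hq : q ≤ d) : b p q = 0 := by
  have key : ∀ A, ∀ p q, p ≤ d → q ≤ d →
      (p < A ∨ d < p + A ∨ q < A ∨ d < q + A) → b p q = 0 := by
    intro A
    induction A with
    | zero => exact fun p q _ _ h => by omega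
    | succ A h0 =>
      have aux : ∀ f : ℕ → M,
          (∀ r < n, ∑ p ∈ Finset.range (d + 1), θ p ^ r • f p = 0) → ∀ q ≤ d,
          (q = A ∨ q + A = d) → f q = 0 →
          (∀ p ≤ d, (p < A ∨ d < p + A ∨ p + n < q ∨ q + n < p) → f p = 0) →
          ∀ p ≤ d, f p = 0 := by
        rintro f hf q hq hqA hfq h1 p hp
        rcases hqA with hqA | hqA
        · refine eq_zero_of_moments hθ hf (Finset.Ico (A + 1) (A + n + 1)) (by simp)
            (fun p' hp' hS => ?_) hp
          simp only [Finset.mem_Ico, not_and, not_lt] at hS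
          by_cases hpq : p' = q
          · rwa [hpq]
          · exact h1 p' hp' (by
              by_cases h2 : A + 1 ≤ p'
              · have := hS h2; omega
              · omega)
        · refine eq_zero_of_moments hθ hf (Finset.Ico (q - n) q) (by simp; omega)
            (fun p' hp' hS => ?_) hp
          simp only [Finset.mem_Ico, not_and, not_lt] at hS
          by_cases hpq : p' = q
          · rwa [hpq]
          · exact h1 p' hp' (by
              by_cases h2 : q - n ≤ p'
              · have := hS h2; omega
              · omega)
      intro p q hp hq h
      by_cases h' : p < A ∨ d < p + A ∨ q < A ∨ d < q + A
      · exact h0 p q hp hq h'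
      by_cases hqA : q = A ∨ q + A = d
      · refine aux (fun p => b p q) (hcol q hq) q hq hqA (hdiag q hq) (fun p' hp' h2 => ?_) p hp
        by_cases h3 : p' < A ∨ d < p' + A
        · exact h0 p' q hp' hq (by omega)
        · exact hband p' q hp' hq (by omega)
      · refine aux (fun q => b p q) (hrow p hp) p hp (by omega) (hdiag p hp)
          (fun q' hq' h2 => ?_) q hq
        by_cases h3 : q' < A ∨ d < q' + A
        · exact h0 p q' hp hq' (by omega)
        · exact hband p q' hp hq' (by omega)
  exact key (d + 1) p q hp hq (by omega)

/-- A three-dimensional array satisfying the triple product relations between `e*_i` and `e*_k`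
vanishes once its slices of index `ℓ ≤ (i + k) / 2` vanish. -/
theorem triple_eq_zero {d : ℕ} {θ θs : ℕ → F}
    (hθ : ∀ i j, i ≤ d → j ≤ d → i ≠ j → θ i ≠ θ j)
    (hθs : ∀ i j, i ≤ d → j ≤ d → i ≠ j → θs i ≠ θs j) {i k : ℕ} {b : ℕ → ℕ → ℕ → M}
    (hmid : ∀ p q, p ≤ d → q ≤ d → ∀ s < max (p - q) (q - p),
      ∑ l ∈ Finset.range (d + 1), θs l ^ s • b l p q = 0)
    (hcol : ∀ l q, l ≤ d → q ≤ d → ∀ r < max (i - l) (l - i),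
      ∑ p ∈ Finset.range (d + 1), θ p ^ r • b l p q = 0)
    (hrow : ∀ l p, l ≤ d → p ≤ d → ∀ r < max (l - k) (k - l),
      ∑ q ∈ Finset.range (d + 1), θ q ^ r • b l p q = 0)
    (h0 : ∀ l p q, l ≤ d → p ≤ d → q ≤ d → 2 * l ≤ i + k → b l p q = 0)
    {l p q : ℕ} (hl : l ≤ d) (hp : p ≤ d) (hq : q ≤ d) : b l p q = 0 := by
  have key : ∀ t, ∀ l p q, l ≤ d → p ≤ d → q ≤ d → d < l + t → b l p q = 0 := by
    intro t
    induction t with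
    | zero => intro l p q hl _ _ h; omega
    | succ t ih =>
      intro l p q hl hp hq hlt
      by_cases hlm : 2 * l ≤ i + k
      · exact h0 l p q hl hp hq hlm
      refine banded_eq_zero hθ (b := b l) (N := l - (i + k) / 2) (m := max (i - l) (l - i))
        (n := max (l - k) (k - l)) (by omega) (fun p q hp hq hpq => ?_)
        (fun q hq => hcol l q hl hq) (fun p hp => hrow l p hl hp) hp hq
      refine eq_zero_of_moments hθs (f := fun l => b l p q) (hmid p q hp hq)
        (Finset.Ioc ((i + k) / 2) l) (by simp; omega) (fun l' hl' hS => ?_) hl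
      simp only [Finset.mem_Ioc, not_and, not_le] at hS
      by_cases h2 : 2 * l' ≤ i + k
      · exact h0 l' p q hl' hp hq h2
      · exact ih l' p q hl' hp hq (by have := hS (by omega); omega)
  exact key (d + 1) l p q hl hp hq (by omega)

/-- A three-dimensional array satisfying the triple product relations between `e*_0` and `e*_0`
is symmetric. -/
theorem triple_symm {d : ℕ} {θ θs : ℕ → F}
    (hθ : ∀ i j, i ≤ d → j ≤ d → i ≠ j → θ i ≠ θ j)
    (hθs : ∀ i j, i ≤ d → j ≤ d → i ≠ j → θs i ≠ θs j) {b : ℕ → ℕ → ℕ → M}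
    (hmid : ∀ p q, p ≤ d → q ≤ d → ∀ s < max (p - q) (q - p),
      ∑ l ∈ Finset.range (d + 1), θs l ^ s • b l p q = 0)
    (hcol : ∀ l q, l ≤ d → q ≤ d → ∀ r < l,
      ∑ p ∈ Finset.range (d + 1), θ p ^ r • b l p q = 0)
    (hrow : ∀ l p, l ≤ d → p ≤ d → ∀ r < l,
      ∑ q ∈ Finset.range (d + 1), θ q ^ r • b l p q = 0)
    {l p q : ℕ} (hl : l ≤ d) (hp : p ≤ d) (hq : q ≤ d) : b l p q = b l q p := by
  have key : ∀ t, ∀ l p q, l ≤ d → p ≤ d → q ≤ d → d < l + t → b l p q - b l q p = 0 := by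
    intro t
    induction t with
    | zero => intro l p q hl _ _ h; omega
    | succ t ih =>
      intro l p q hl hp hq hlt
      refine banded_eq_zero_of_diag hθ (b := fun p q => b l p q - b l q p) (n := l)
        (fun p _ => sub_self _) (fun p q hp hq hpq => ?_) (fun q hq r hr => ?_)
        (fun p hp r hr => ?_) hp hq
      · refine eq_zero_of_moments hθs (f := fun l => b l p q - b l q p)
          (n := max (p - q) (q - p)) (fun s hs => ?_)
          (Finset.range (l + 1)) (by simp; omega) (fun l' hl' hS => ?_) hl
        · simp only [smul_sub, Finset.sum_sub_distrib]
          rw [hmid p q hp hq s hs, hmid q p hq hp s (by omega), sub_zero]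
        · rw [Finset.mem_range] at hS
          exact ih l' p q hl' hp hq (by omega)
      · simp only [smul_sub, Finset.sum_sub_distrib]
        rw [hcol l q hl hq r hr, hrow l q hl hq r hr, sub_zero]
      · simp only [smul_sub, Finset.sum_sub_distrib]
        rw [hcol l p hl hp r hr, hrow l p hl hp r hr, sub_zero]
  exact sub_eq_zero.1 (key (d + 1) l p q hl hp hq (by omega))

end Moments

section Algebra

variable {F : Type*} [Field F] {R : Type*} [Ring R] [Algebra F R]

/-- The relations between two systems of elements `e_i`, `e*_i` of an algebra that are used to
study `e*_0 R e*_0`. -/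
structure TriRelations (d : ℕ) (θ θs : ℕ → F) (e es : ℕ → R) : Prop where
  sum_e : ∑ p ∈ Finset.range (d + 1), e p = 1
  sum_es : ∑ p ∈ Finset.range (d + 1), es p = 1
  es_mul : ∀ i j, i ≤ d → j ≤ d → es i * es j = if i = j then es i else 0
  trid : ∀ i j, i ≤ d → j ≤ d → ∀ k < max (i - j) (j - i),
    ∑ p ∈ Finset.range (d + 1), θ p ^ k • (es i * e p * es j) = 0
  tridstar : ∀ i j, i ≤ d → j ≤ d → ∀ k < max (i - j) (j - i),
    ∑ l ∈ Finset.range (d + 1), θs l ^ k • (e i * es l * e j) = 0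

namespace TriRelations

variable {d : ℕ} {θ θs : ℕ → F} {e es : ℕ → R}

theorem sum_mid (H : TriRelations d θ θs e es) (x y : R) {p q s : ℕ} (hp : p ≤ d) (hq : q ≤ d)
    (hs : s < max (p - q) (q - p)) :
    ∑ l ∈ Finset.range (d + 1), θs l ^ s • (x * e p * es l * e q * y) = 0 := by
  have h := congrArg (fun z => x * z * y) (H.tridstar p q hp hq s hs)
  simpa only [Finset.mul_sum, Finset.sum_mul, mul_smul_comm, smul_mul_assoc, mul_zero, zero_mul,
    mul_assoc] using h

theorem sum_left (H : TriRelations d θ θs e es) (y : R) {i l r : ℕ} (hi : i ≤ d) (hl : l ≤ d)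
    (hr : r < max (i - l) (l - i)) :
    ∑ p ∈ Finset.range (d + 1), θ p ^ r • (es i * e p * es l * y) = 0 := by
  have h := congrArg (fun z => z * y) (H.trid i l hi hl r hr)
  simpa only [Finset.sum_mul, smul_mul_assoc, zero_mul] using h

theorem sum_right (H : TriRelations d θ θs e es) (x : R) {l k r : ℕ} (hl : l ≤ d) (hk : k ≤ d)
    (hr : r < max (l - k) (k - l)) :
    ∑ q ∈ Finset.range (d + 1), θ q ^ r • (x * es l * e q * es k) = 0 := by
  have h := congrArg (fun z => x * z) (H.trid l k hl hk r hr)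
  simpa only [Finset.mul_sum, mul_smul_comm, mul_zero, mul_assoc] using h

/-- The element `e*_i e_p e*_l e_q e*_k` lies in the span of the elements of the same form
whose middle index is at most `(i + k) / 2`. -/
theorem triple_mem_span (H : TriRelations d θ θs e es)
    (hθ : ∀ i j, i ≤ d → j ≤ d → i ≠ j → θ i ≠ θ j)
    (hθs : ∀ i j, i ≤ d → j ≤ d → i ≠ j → θs i ≠ θs j) {i k l p q : ℕ}
    (hi : i ≤ d) (hk : k ≤ d) (hl : l ≤ d) (hp : p ≤ d) (hq : q ≤ d) :
    es i * e p * es l * e q * es k ∈ Submodule.span F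
      {x | ∃ l' p' q', l' ≤ d ∧ p' ≤ d ∧ q' ≤ d ∧ 2 * l' ≤ i + k ∧
        x = es i * e p' * es l' * e q' * es k} := by
  set W := Submodule.span F
      {x | ∃ l' p' q', l' ≤ d ∧ p' ≤ d ∧ q' ≤ d ∧ 2 * l' ≤ i + k ∧
        x = es i * e p' * es l' * e q' * es k}
  rw [← Submodule.Quotient.mk_eq_zero]
  refine triple_eq_zero hθ hθs (i := i) (k := k)
    (b := fun l p q => (Submodule.Quotient.mk (es i * e p * es l * e q * es k) : R ⧸ W))
    ?_ ?_ ?_ ?_ hl hp hq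
  · intro p q hp hq s hs
    simpa using congrArg W.mkQ (H.sum_mid (es i) (es k) hp hq hs)
  · intro l q hl _ r hr
    simpa [mul_assoc] using congrArg W.mkQ (H.sum_left (e q * es k) hi hl hr)
  · intro l p hl _ r hr
    simpa using congrArg W.mkQ (H.sum_right (es i * e p) hl hk hr)
  · intro l p q hl hp hq h
    rw [Submodule.Quotient.mk_eq_zero]
    exact Submodule.subset_span ⟨l, p, q, hl, hp, hq, h, rfl⟩

theorem corner_e_commute (H : TriRelations d θ θs e es)
    (hθ : ∀ i j, i ≤ d → j ≤ d → i ≠ j → θ i ≠ θ j)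
    (hθs : ∀ i j, i ≤ d → j ≤ d → i ≠ j → θs i ≠ θs j) {p q : ℕ} (hp : p ≤ d) (hq : q ≤ d) :
    Commute (es 0 * e p * es 0) (es 0 * e q * es 0) := by
  have h := triple_symm hθ hθs (b := fun l p q => es 0 * e p * es l * e q * es 0)
    (fun p q hp hq s hs => H.sum_mid _ _ hp hq hs)
    (fun l q hl _ r hr => by
      simpa only [mul_assoc] using H.sum_left (e q * es 0) (Nat.zero_le d) hl (by omega))
    (fun l p hl _ r hr => H.sum_right (es 0 * e p) hl (Nat.zero_le d) (by omega))
    (Nat.zero_le d) hp hq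
  have h0 : es 0 * es 0 = es 0 := by simpa using H.es_mul 0 0 (Nat.zero_le d) (Nat.zero_le d)
  have h1 : ∀ p q, es 0 * e p * es 0 * (es 0 * e q * es 0) = es 0 * e p * es 0 * e q * es 0 := by
    intro p q
    rw [mul_assoc (es 0) (e q), ← mul_assoc (es 0 * e p * es 0), mul_assoc (es 0 * e p) (es 0),
      h0]
    simp only [mul_assoc]
  rw [Commute, SemiconjBy, h1, h1]
  exact h

/-- Products `e*_0 e_{p_1} e*_{k_1} ⋯ e_{p_m} e*_k` whose indices `0, k_1, …, k_{m-1}` are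
all at most `n`. -/
inductive StarWord (d : ℕ) (e es : ℕ → R) (n : ℕ) : ℕ → R → Prop
  | base : StarWord d e es n 0 (es 0)
  | step {i k p : ℕ} {w : R} : StarWord d e es n i w → i ≤ n → k ≤ d → p ≤ d →
      StarWord d e es n k (w * e p * es k)

/-- The span of the products `e*_0 e_{p_1} e*_{k_1} ⋯ e_{p_m} e*_k` with intermediate indices
at most `n`. -/
def starWordSpan (F : Type*) [Field F] [Algebra F R] (d : ℕ) (e es : ℕ → R) (n k : ℕ) :
    Submodule F R :=
  Submodule.span F {w | StarWord d e es n k w}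

theorem StarWord.le {n k : ℕ} {w : R} (h : StarWord d e es n k w) : k ≤ d := by
  cases h with
  | base => exact Nat.zero_le d
  | step _ _ hk _ => exact hk

theorem StarWord.mul_es (H : TriRelations d θ θs e es) {n k : ℕ} {w : R}
    (h : StarWord d e es n k w) {j : ℕ} (hj : j ≤ d) :
    w * es j = if k = j then w else 0 := by
  cases h with
  | base => exact H.es_mul 0 j (Nat.zero_le d) hj
  | step _ _ hk _ =>
    rw [mul_assoc, H.es_mul k j hk hj]
    split_ifs <;> simp

theorem mul_mul_mem_starWordSpan {n i k p : ℕ} {x : R} (hx : x ∈ starWordSpan F d e es n i)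
    (hi : i ≤ n) (hk : k ≤ d) (hp : p ≤ d) :
    x * e p * es k ∈ starWordSpan F d e es n k := by
  have h : starWordSpan F d e es n i ≤ (starWordSpan F d e es n k).comap
      ((LinearMap.mulRight F (es k)).comp (LinearMap.mulRight F (e p))) :=
    Submodule.span_le.2 fun w hw => Submodule.subset_span (StarWord.step hw hi hk hp)
  exact h hx

/-- Intermediate indices equal to `n + 1` can be eliminated. -/
theorem StarWord.mem_span_pred (H : TriRelations d θ θs e es)
    (hθ : ∀ i j, i ≤ d → j ≤ d → i ≠ j → θ i ≠ θ j)
    (hθs : ∀ i j, i ≤ d → j ≤ d → i ≠ j → θs i ≠ θs j) {n k : ℕ} {w : R}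
    (h : StarWord d e es (n + 1) k w) (hkn : k ≤ n + 1) : w ∈ starWordSpan F d e es n k := by
  induction h with
  | base => exact Submodule.subset_span StarWord.base
  | @step i k p v hv hi hk hp ih =>
    have ih := ih hi
    by_cases hin : i ≤ n
    · exact mul_mul_mem_starWordSpan ih hin hk hp
    obtain rfl : i = n + 1 := by omega
    have hle : starWordSpan F d e es n (n + 1) ≤ (starWordSpan F d e es n k).comap
        ((LinearMap.mulRight F (es k)).comp (LinearMap.mulRight F (e p))) := by
      refine Submodule.span_le.2 fun u hu => ?_
      cases hu with
      | @step j _ q x hx hj hn hq =>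
        have hjd := hx.le
        have hxj : x * es j = x := by simpa using hx.mul_es H hjd
        have hspan := H.triple_mem_span hθ hθs hjd hk hn hq hp
        have hsub : Submodule.span F
            {x | ∃ l' p' q', l' ≤ d ∧ p' ≤ d ∧ q' ≤ d ∧ 2 * l' ≤ j + k ∧
              x = es j * e p' * es l' * e q' * es k} ≤
            (starWordSpan F d e es n k).comap (LinearMap.mulLeft F x) := by
          refine Submodule.span_le.2 ?_
          rintro _ ⟨l', p', q', hl', hp', hq', hl, rfl⟩
          have hw := StarWord.step (StarWord.step hx hj hl' hp') (by omega : l' ≤ n) hk hq'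
          have heq : x * (es j * e p' * es l' * e q' * es k) = x * e p' * es l' * e q' * es k := by
            simp only [← mul_assoc, hxj]
          change x * (es j * e p' * es l' * e q' * es k) ∈ starWordSpan F d e es n k
          rw [heq]
          exact Submodule.subset_span hw
        have hmem : x * (es j * e q * es (n + 1) * e p * es k) ∈ starWordSpan F d e es n k :=
          hsub hspan
        simp only [← mul_assoc, hxj] at hmem
        exact hmem
    exact hle ih

theorem starWordSpan_zero_le (H : TriRelations d θ θs e es)
    (hθ : ∀ i j, i ≤ d → j ≤ d → i ≠ j → θ i ≠ θ j)
    (hθs : ∀ i j, i ≤ d → j ≤ d → i ≠ j → θs i ≠ θs j) (n : ℕ) :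
    starWordSpan F d e es n 0 ≤ starWordSpan F d e es 0 0 := by
  induction n with
  | zero => exact le_rfl
  | succ n ih =>
    exact (Submodule.span_le.2 fun w hw =>
      StarWord.mem_span_pred H hθ hθs hw (Nat.zero_le _)).trans ih

/-- If the `e_i` and the `e*_i` generate the algebra, then every element of the corner is a
combination of products of the elements `e*_0 e_p e*_0`. -/
theorem corner_mem_starWordSpan (H : TriRelations d θ θs e es)
    (hθ : ∀ i j, i ≤ d → j ≤ d → i ≠ j → θ i ≠ θ j)
    (hθs : ∀ i j, i ≤ d → j ≤ d → i ≠ j → θs i ≠ θs j)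
    (hgen : Algebra.adjoin F {x : R | ∃ i ≤ d, x = e i ∨ x = es i} = ⊤) (t : R) :
    es 0 * t * es 0 ∈ starWordSpan F d e es 0 0 := by
  set N : Submodule F R := ⨆ k, starWordSpan F d e es d k
  have hle : ∀ k, starWordSpan F d e es d k ≤ N := fun k => le_iSup _ k
  have hNes : ∀ j ≤ d, ∀ x ∈ N, x * es j ∈ starWordSpan F d e es d j := by
    intro j hj
    have : N ≤ (starWordSpan F d e es d j).comap (LinearMap.mulRight F (es j)) := by
      refine iSup_le fun k => Submodule.span_le.2 fun w hw => ?_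
      change w * es j ∈ starWordSpan F d e es d j
      rw [StarWord.mul_es H hw hj]
      split_ifs with hkj
      · exact hkj ▸ Submodule.subset_span hw
      · exact zero_mem _
    exact fun x hx => this hx
  have hNe : ∀ p ≤ d, ∀ x ∈ N, x * e p ∈ N := by
    intro p hp
    have : N ≤ N.comap (LinearMap.mulRight F (e p)) := by
      refine iSup_le fun k => Submodule.span_le.2 fun w hw => ?_
      change w * e p ∈ N
      rw [← mul_one (w * e p), ← H.sum_es, Finset.mul_sum]
      refine sum_mem fun j hj => hle j (Submodule.subset_span ?_)
      exact StarWord.step hw hw.le (by have := Finset.mem_range.1 hj; omega) hp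
    exact fun x hx => this hx
  have hright : ∀ t : R, ∀ x ∈ N, x * t ∈ N := by
    intro t
    have ht : t ∈ Algebra.adjoin F {x : R | ∃ i ≤ d, x = e i ∨ x = es i} := by
      rw [hgen]; exact Algebra.mem_top
    induction ht using Algebra.adjoin_induction with
    | mem y hy =>
      obtain ⟨i, hi, rfl | rfl⟩ := hy
      · exact hNe i hi
      · exact fun x hx => hle i (hNes i hi x hx)
    | algebraMap c =>
      intro x hx
      rw [← Algebra.commutes, ← Algebra.smul_def]
      exact N.smul_mem c hx
    | add y z _ _ hy hz =>
      intro x hx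
      rw [mul_add]
      exact N.add_mem (hy x hx) (hz x hx)
    | mul y z _ _ hy hz =>
      intro x hx
      rw [← mul_assoc]
      exact hz _ (hy x hx)
  have h0 : es 0 ∈ N := hle 0 (Submodule.subset_span StarWord.base)
  exact H.starWordSpan_zero_le hθ hθs d (hNes 0 (Nat.zero_le d) _ (hright t _ h0))

/-- A subspace containing `e*_0` and closed under right multiplication by all `e*_0 e_p e*_0`
contains the corner. -/
theorem corner_mem (H : TriRelations d θ θs e es)
    (hθ : ∀ i j, i ≤ d → j ≤ d → i ≠ j → θ i ≠ θ j)
    (hθs : ∀ i j, i ≤ d → j ≤ d → i ≠ j → θs i ≠ θs j)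
    (hgen : Algebra.adjoin F {x : R | ∃ i ≤ d, x = e i ∨ x = es i} = ⊤)
    {C : Submodule F R} (h0 : es 0 ∈ C) (hC : ∀ p ≤ d, ∀ x ∈ C, x * (es 0 * e p * es 0) ∈ C)
    (t : R) : es 0 * t * es 0 ∈ C := by
  have hw : ∀ k w, StarWord d e es 0 k w → k = 0 → w ∈ C := by
    intro k w h
    induction h with
    | base => exact fun _ => h0
    | @step i k p v hv hi hk hp ih =>
      rintro rfl
      obtain rfl : i = 0 := by omega
      have hv0 : v * es 0 = v := by simpa using hv.mul_es H (Nat.zero_le d)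
      have := hC p hp v (ih rfl)
      rwa [← mul_assoc, ← mul_assoc, hv0] at this
  exact (Submodule.span_le.2 fun w h => hw 0 w h rfl :
    starWordSpan F d e es 0 0 ≤ C) (H.corner_mem_starWordSpan hθ hθs hgen t)

end TriRelations

/-- An idempotent `u` together with commuting elements `g_i` of `u R u` gives a homomorphism
from the polynomial algebra to `u R u`. -/
theorem exists_mvPolynomial_corner {ι : Type*} {u : R} (hu : u * u = u) (g : ι → R)
    (hug : ∀ i, u * g i = g i) (hgu : ∀ i, g i * u = g i) (hg : ∀ i j, Commute (g i) (g j)) :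
    ∃ μ : MvPolynomial ι F →ₗ[F] R, μ 1 = u ∧ (∀ p q, μ (p * q) = μ p * μ q) ∧
      (∀ i, μ (MvPolynomial.X i) = g i) ∧ ∀ p, u * μ p * u = μ p := by
  let s : Set R := insert u (Set.range g)
  have hs : ∀ a ∈ s, ∀ b ∈ s, a * b = b * a := by
    rintro a (rfl | ⟨i, rfl⟩) b (rfl | ⟨j, rfl⟩)
    · rfl
    · rw [hug, hgu]
    · rw [hug, hgu]
    · exact hg i j
  let _ : CommRing (Algebra.adjoin F s) :=
    { mul_comm := (Algebra.isMulCommutative_adjoin F hs).is_comm.comm }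
  let u' : Algebra.adjoin F s := ⟨u, Algebra.subset_adjoin (Set.mem_insert _ _)⟩
  let g' : ι → Algebra.adjoin F s := fun i =>
    ⟨g i, Algebra.subset_adjoin (Set.mem_insert_of_mem _ ⟨i, rfl⟩)⟩
  have hu' : u' * u' = u' := Subtype.ext hu
  let ν : MvPolynomial ι F →ₐ[F] Algebra.adjoin F s := MvPolynomial.aeval g'
  have hval : ∀ p q : MvPolynomial ι F, ν (p * q) * u' = (ν p * u') * (ν q * u') := by
    intro p q
    rw [map_mul, mul_mul_mul_comm, hu']
  refine ⟨(Algebra.adjoin F s).val.toLinearMap.comp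
    ((LinearMap.mulRight F u').comp ν.toLinearMap), ?_, ?_, ?_, ?_⟩
  · change ((ν 1 * u' : Algebra.adjoin F s) : R) = u
    rw [map_one, one_mul]
  · exact fun p q => congrArg Subtype.val (hval p q)
  · intro i
    change ((ν (MvPolynomial.X i) * u' : Algebra.adjoin F s) : R) = g i
    rw [MvPolynomial.aeval_X]
    exact hgu i
  · intro p
    have h : u' * (ν p * u') * u' = ν p * u' := by
      rw [mul_comm u', mul_assoc, mul_assoc, hu', hu']
    exact congrArg Subtype.val h

end Algebra

section Presentation

variable {F : Type*} [Field F] {d : ℕ} {θ θs : ℕ → F}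

theorem eT_of_fin (i : Fin (d + 1)) : eT F d θ θs i = tgen F d θ θs (TGen.e i) := by
  simp [eT, i.isLt, -Order.lt_add_one_iff]

theorem esT_of_fin (i : Fin (d + 1)) : esT F d θ θs i = tgen F d θ θs (TGen.estar i) := by
  simp [esT, i.isLt, -Order.lt_add_one_iff]

theorem mkAlgHom_eq_of_TRel {x y : FreeAlgebra F (TGen d)} (h : TRel F d θ θs x y) :
    RingQuot.mkAlgHom F (TRel F d θ θs) x = RingQuot.mkAlgHom F (TRel F d θ θs) y :=
  RingQuot.mkAlgHom_rel F h

theorem eT_mul (i j : Fin (d + 1)) :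
    eT F d θ θs i * eT F d θ θs j = if i = j then eT F d θ θs i else 0 := by
  have h := mkAlgHom_eq_of_TRel (TRel.ee (F := F) (θ := θ) (θs := θs) i j)
  rw [map_mul, apply_ite (RingQuot.mkAlgHom F (TRel F d θ θs)), map_zero] at h
  rw [eT_of_fin, eT_of_fin]
  exact h

theorem esT_mul (i j : Fin (d + 1)) :
    esT F d θ θs i * esT F d θ θs j = if i = j then esT F d θ θs i else 0 := by
  have h := mkAlgHom_eq_of_TRel (TRel.eses (F := F) (θ := θ) (θs := θs) i j)
  rw [map_mul, apply_ite (RingQuot.mkAlgHom F (TRel F d θ θs)), map_zero] at h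
  rw [esT_of_fin, esT_of_fin]
  exact h

theorem sum_eT : ∑ i : Fin (d + 1), eT F d θ θs i = 1 := by
  have h := mkAlgHom_eq_of_TRel (TRel.sum_e (F := F) (d := d) (θ := θ) (θs := θs))
  rw [map_sum, map_one] at h
  simp_rw [eT_of_fin]
  exact h

theorem sum_esT : ∑ i : Fin (d + 1), esT F d θ θs i = 1 := by
  have h := mkAlgHom_eq_of_TRel (TRel.sum_estar (F := F) (d := d) (θ := θ) (θs := θs))
  rw [map_sum, map_one] at h
  simp_rw [esT_of_fin]
  exact h

theorem aT_eq : aT F d θ θs = ∑ i : Fin (d + 1), θ i • eT F d θ θs i := by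
  have h := mkAlgHom_eq_of_TRel (TRel.a_eq (F := F) (d := d) (θ := θ) (θs := θs))
  rw [map_sum] at h
  simp_rw [map_smul] at h
  simp_rw [eT_of_fin]
  exact h

theorem asT_eq : asT F d θ θs = ∑ i : Fin (d + 1), θs i • esT F d θ θs i := by
  have h := mkAlgHom_eq_of_TRel (TRel.astar_eq (F := F) (d := d) (θ := θ) (θs := θs))
  rw [map_sum] at h
  simp_rw [map_smul] at h
  simp_rw [esT_of_fin]
  exact h

/-- Polynomials in a combination of orthogonal idempotents. -/
theorem aeval_sum_smul_idempotents {R ι : Type*} [Ring R] [Algebra F R] [Fintype ι]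
    [DecidableEq ι] {e : ι → R} (he : ∀ i j, e i * e j = if i = j then e i else 0)
    (hsum : ∑ i, e i = 1) (t : ι → F) (P : Polynomial F) :
    Polynomial.aeval (∑ i, t i • e i) P = ∑ i, P.eval (t i) • e i := by
  induction P using Polynomial.induction_on' with
  | add P Q hP hQ =>
    simp only [map_add, hP, hQ, Polynomial.eval_add, add_smul, Finset.sum_add_distrib]
  | monomial n c =>
    induction n generalizing c with
    | zero =>
      simp only [Polynomial.monomial_zero_left, Polynomial.aeval_C, Polynomial.eval_C]
      rw [← Finset.smul_sum, hsum, Algebra.algebraMap_eq_smul_one]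
    | succ n ih =>
      rw [← Polynomial.monomial_mul_X, map_mul, ih, Polynomial.aeval_X, Finset.sum_mul]
      refine Finset.sum_congr rfl fun i _ => ?_
      rw [Finset.mul_sum, Finset.sum_eq_single i]
      · rw [smul_mul_smul_comm, he, if_pos rfl, Polynomial.eval_mul, Polynomial.eval_X]
      · intro j _ hj
        rw [smul_mul_smul_comm, he, if_neg hj.symm, smul_zero]
      · exact fun h => absurd (Finset.mem_univ i) h

theorem aeval_aT (P : Polynomial F) :
    Polynomial.aeval (aT F d θ θs) P =
      ∑ p ∈ Finset.range (d + 1), P.eval (θ p) • eT F d θ θs p := by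
  rw [aT_eq, aeval_sum_smul_idempotents eT_mul sum_eT, Finset.sum_range]

theorem aeval_asT (P : Polynomial F) :
    Polynomial.aeval (asT F d θ θs) P =
      ∑ p ∈ Finset.range (d + 1), P.eval (θs p) • esT F d θ θs p := by
  rw [asT_eq, aeval_sum_smul_idempotents esT_mul sum_esT, Finset.sum_range]

theorem triRelations_TAlg : TriRelations d θ θs (eT F d θ θs) (esT F d θ θs) where
  sum_e := by rw [Finset.sum_range]; exact sum_eT
  sum_es := by rw [Finset.sum_range]; exact sum_esT
  es_mul i j hi hj := by
    have h := esT_mul (F := F) (θ := θ) (θs := θs) (⟨i, by omega⟩ : Fin (d + 1)) ⟨j, by omega⟩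
    simpa only [Fin.mk.injEq] using h
  trid i j hi hj k hk := by
    have h := mkAlgHom_eq_of_TRel (TRel.trid (F := F) (θ := θ) (θs := θs)
      (⟨i, by omega⟩ : Fin (d + 1)) ⟨j, by omega⟩ k (by omega) hk)
    rw [map_mul, map_mul, map_pow, map_zero] at h
    have ha : aT F d θ θs ^ k = ∑ p ∈ Finset.range (d + 1), θ p ^ k • eT F d θ θs p := by
      simpa using aeval_aT (F := F) (d := d) (θ := θ) (θs := θs) (X ^ k)
    change tgen F d θ θs _ * aT F d θ θs ^ k * tgen F d θ θs _ = 0 at h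
    rw [← esT_of_fin, ← esT_of_fin, ha] at h
    simpa only [Finset.mul_sum, Finset.sum_mul, mul_smul_comm, smul_mul_assoc] using h
  tridstar i j hi hj k hk := by
    have h := mkAlgHom_eq_of_TRel (TRel.tridstar (F := F) (θ := θ) (θs := θs)
      (⟨i, by omega⟩ : Fin (d + 1)) ⟨j, by omega⟩ k (by omega) hk)
    rw [map_mul, map_mul, map_pow, map_zero] at h
    have ha : asT F d θ θs ^ k = ∑ p ∈ Finset.range (d + 1), θs p ^ k • esT F d θ θs p := by
      simpa using aeval_asT (F := F) (d := d) (θ := θ) (θs := θs) (X ^ k)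
    change tgen F d θ θs _ * asT F d θ θs ^ k * tgen F d θ θs _ = 0 at h
    rw [← eT_of_fin, ← eT_of_fin, ha] at h
    simpa only [Finset.mul_sum, Finset.sum_mul, mul_smul_comm, smul_mul_assoc] using h

theorem adjoin_idempotents_eq_top :
    Algebra.adjoin F {x : TAlg F d θ θs | ∃ i ≤ d, x = eT F d θ θs i ∨ x = esT F d θ θs i} =
      ⊤ := by
  set S := Algebra.adjoin F
    {x : TAlg F d θ θs | ∃ i ≤ d, x = eT F d θ θs i ∨ x = esT F d θ θs i}
  have he : ∀ i : Fin (d + 1), eT F d θ θs i ∈ S := fun i =>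
    Algebra.subset_adjoin ⟨i, by omega, Or.inl rfl⟩
  have hes : ∀ i : Fin (d + 1), esT F d θ θs i ∈ S := fun i =>
    Algebra.subset_adjoin ⟨i, by omega, Or.inr rfl⟩
  have hgen : ∀ g : TGen d, tgen F d θ θs g ∈ S := by
    rintro (_ | _ | i | i)
    · change aT F d θ θs ∈ S
      rw [aT_eq]
      exact sum_mem fun i _ => S.smul_mem (he i) _
    · change asT F d θ θs ∈ S
      rw [asT_eq]
      exact sum_mem fun i _ => S.smul_mem (hes i) _
    · exact eT_of_fin (F := F) (θ := θ) (θs := θs) i ▸ he i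
    · exact esT_of_fin (F := F) (θ := θ) (θs := θs) i ▸ hes i
  rw [eq_top_iff]
  rintro t -
  obtain ⟨x, rfl⟩ := RingQuot.mkAlgHom_surjective F (TRel F d θ θs) t
  induction x using FreeAlgebra.induction with
  | grade0 c => rw [AlgHom.commutes]; exact S.algebraMap_mem c
  | grade1 g => exact hgen g
  | mul x y hx hy => rw [map_mul]; exact S.mul_mem hx hy
  | add x y hx hy => rw [map_add]; exact S.add_mem hx hy

theorem eval_tauPoly_of_lt {i p : ℕ} (h : p < i) : (tauPoly θ i).eval (θ p) = 0 := by
  rw [tauPoly, Polynomial.eval_prod]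
  exact Finset.prod_eq_zero (Finset.mem_range.2 h) (by simp)

theorem eval_tauPoly_self_ne_zero (hθ : ∀ i j, i ≤ d → j ≤ d → i ≠ j → θ i ≠ θ j) {i : ℕ}
    (hi : i ≤ d) : (tauPoly θ i).eval (θ i) ≠ 0 := by
  rw [tauPoly, Polynomial.eval_prod, Finset.prod_ne_zero_iff]
  intro j hj
  have := Finset.mem_range.1 hj
  simpa [sub_ne_zero] using hθ i j hi (by omega) (by omega)

theorem corner_tau_eq (i : ℕ) :
    esT F d θ θs 0 * Polynomial.aeval (aT F d θ θs) (tauPoly θ i) * esT F d θ θs 0 =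
      ∑ p ∈ Finset.range (d + 1), (tauPoly θ i).eval (θ p) •
        (esT F d θ θs 0 * eT F d θ θs p * esT F d θ θs 0) := by
  rw [aeval_aT]
  simp only [Finset.mul_sum, Finset.sum_mul, mul_smul_comm, smul_mul_assoc]

/-- A subspace containing all `e*_0 τ_i(a) e*_0` contains all `e*_0 e_p e*_0`. -/
theorem corner_e_mem (hθ : ∀ i j, i ≤ d → j ≤ d → i ≠ j → θ i ≠ θ j)
    {C : Submodule F (TAlg F d θ θs)}
    (hC : ∀ i ≤ d, esT F d θ θs 0 * Polynomial.aeval (aT F d θ θs) (tauPoly θ i) *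
      esT F d θ θs 0 ∈ C) {p : ℕ} (hp : p ≤ d) :
    esT F d θ θs 0 * eT F d θ θs p * esT F d θ θs 0 ∈ C := by
  have key : ∀ n, ∀ p ≤ d, d < p + n →
      esT F d θ θs 0 * eT F d θ θs p * esT F d θ θs 0 ∈ C := by
    intro n
    induction n with
    | zero => intro p hp h; omega
    | succ n ih =>
      intro p hp hpn
      have h := hC p hp
      rw [corner_tau_eq, ← Finset.add_sum_erase _ _ (Finset.mem_range.2 (by omega : p < d + 1)),
        Submodule.add_mem_iff_left, Submodule.smul_mem_iff _ (eval_tauPoly_self_ne_zero hθ hp)] at h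
      · exact h
      · refine sum_mem fun q hq => ?_
        rw [Finset.mem_erase, Finset.mem_range] at hq
        rcases lt_or_gt_of_ne hq.1 with hlt | hgt
        · rw [eval_tauPoly_of_lt hlt, zero_smul]
          exact zero_mem _
        · exact C.smul_mem _ (ih q (by omega) (by omega))
  exact key (d + 1) p hp (by omega)

theorem corner_tau_commute (hθ : ∀ i j, i ≤ d → j ≤ d → i ≠ j → θ i ≠ θ j)
    (hθs : ∀ i j, i ≤ d → j ≤ d → i ≠ j → θs i ≠ θs j) (i j : ℕ) :
    Commute
      (esT F d θ θs 0 * Polynomial.aeval (aT F d θ θs) (tauPoly θ i) * esT F d θ θs 0)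
      (esT F d θ θs 0 * Polynomial.aeval (aT F d θ θs) (tauPoly θ j) * esT F d θ θs 0) := by
  rw [corner_tau_eq, corner_tau_eq]
  refine Commute.sum_left _ _ _ fun p hp => Commute.sum_right _ _ _ fun q hq => ?_
  rw [Finset.mem_range] at hp hq
  exact ((triRelations_TAlg.corner_e_commute hθ hθs (by omega) (by omega)).smul_left _).smul_right _

end Presentation

theorem exists_muProps {F : Type*} [Field F] {d : ℕ} {θ θs : ℕ → F}
    (hθ : ∀ i j, i ≤ d → j ≤ d → i ≠ j → θ i ≠ θ j)
    (hθs : ∀ i j, i ≤ d → j ≤ d → i ≠ j → θs i ≠ θs j) :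
    ∃ μ : MvPolynomial (Fin d) F →ₗ[F] TAlg F d θ θs, MuProps F d θ θs μ := by
  have H := triRelations_TAlg (F := F) (d := d) (θ := θ) (θs := θs)
  have hu : esT F d θ θs 0 * esT F d θ θs 0 = esT F d θ θs 0 := by
    simpa using H.es_mul 0 0 (Nat.zero_le d) (Nat.zero_le d)
  obtain ⟨μ, h1, hmul, hX, hcorner⟩ := exists_mvPolynomial_corner (F := F) hu
    (fun i : Fin d => esT F d θ θs 0 *
      Polynomial.aeval (aT F d θ θs) (tauPoly θ ((i : ℕ) + 1)) * esT F d θ θs 0)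
    (fun i => by rw [← mul_assoc, ← mul_assoc, hu])
    (fun i => by rw [mul_assoc, hu])
    (fun i j => corner_tau_commute hθ hθs _ _)
  refine ⟨μ, h1, hmul, hX, le_antisymm ?_ ?_⟩
  · rintro _ ⟨p, rfl⟩
    refine ⟨μ p, ?_⟩
    change esT F d θ θs 0 * (μ p * esT F d θ θs 0) = μ p
    rw [← mul_assoc, hcorner]
  · rintro _ ⟨t, rfl⟩
    change esT F d θ θs 0 * (t * esT F d θ θs 0) ∈ LinearMap.range μ
    rw [← mul_assoc]
    refine H.corner_mem hθ hθs adjoin_idempotents_eq_top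
      (C := LinearMap.range μ) ⟨1, h1⟩ (fun p hp x hx => ?_) t
    have hmem : esT F d θ θs 0 * eT F d θ θs p * esT F d θ θs 0 ∈ LinearMap.range μ := by
      refine corner_e_mem hθ (fun i hi => ?_) hp
      cases i with
      | zero => exact ⟨1, by simp [h1, tauPoly, hu]⟩
      | succ i => exact ⟨MvPolynomial.X ⟨i, by omega⟩, hX _⟩
    obtain ⟨f, rfl⟩ := hx
    obtain ⟨g, hg⟩ := hmem
    exact ⟨f * g, by rw [hmul, hg]⟩

/-- The `F`-algebra `e*_0 T e*_0` (with identity `e*_0`) is commutative and generated by the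
elements `e*_0 τ_i(a) e*_0` for `1 ≤ i ≤ d`; consequently there is a surjective `F`-algebra
homomorphism `μ : F[x_1,…,x_d] → e*_0 T e*_0` with `x_i ↦ e*_0 τ_i(a) e*_0`. -/
theorem stmt5 {F : Type*} [Field F] (d : ℕ) (θ θs : ℕ → F) (h : EigCond F d θ θs) :
    (∀ x ∈ corner F d θ θs, ∀ y ∈ corner F d θ θs, x * y = y * x) ∧
    (∃ μ : MvPolynomial (Fin d) F →ₗ[F] TAlg F d θ θs, MuProps F d θ θs μ) := by
  obtain ⟨μ, hμ⟩ := exists_muProps h.1 h.2.1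
  refine ⟨fun x hx y hy => ?_, μ, hμ⟩
  rw [← hμ.2.2.2] at hx hy
  obtain ⟨p, rfl⟩ := hx
  obtain ⟨q, rfl⟩ := hy
  rw [← hμ.2.1, ← hμ.2.1, mul_comm]
end

section
/- Assume that μ is an isomorphism. Then e*_0Te*_0 = F e*_0 + (e*_0Te*_0 ∩ J), and this sum of F-subspaces is direct. -/
open Polynomial

theorem esT_zero_mul_self {F : Type*} [Field F] (d : ℕ) (θ θs : ℕ → F) :
    esT F d θ θs 0 * esT F d θ θs 0 = esT F d θ θs 0 := by
  have h := RingQuot.mkAlgHom_rel F (TRel.eses (F := F) (θ := θ) (θs := θs)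
    (⟨0, d.succ_pos⟩ : Fin (d + 1)) ⟨0, d.succ_pos⟩)
  simpa [esT, tgen] using h

/-- The coefficient `ζ_i / ((θ*_0−θ*_1)⋯(θ*_0−θ*_i))`, as a point of `F^d`. -/
noncomputable def splitPoint {F : Type*} [Field F] (d : ℕ) (θs ζ : ℕ → F) (i : Fin d) : F :=
  ζ (i + 1) / ∏ h ∈ Finset.Icc 1 ((i : ℕ) + 1), (θs 0 - θs h)

section

variable {F : Type*} [Field F] {d : ℕ} {θ θs : ℕ → F}
  {μ : MvPolynomial (Fin d) F →ₗ[F] TAlg F d θ θs}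

theorem MuProps.map_X_sub_C (hμ : MuProps F d θ θs μ) (ζ : ℕ → F) (i : Fin d) :
    μ (MvPolynomial.X i - MvPolynomial.C (splitPoint d θs ζ i)) =
      gElt F d θ θs ζ ((i : ℕ) + 1) := by
  rw [map_sub, hμ.2.2.1, ← mul_one (MvPolynomial.C _), ← MvPolynomial.smul_eq_C_mul, map_smul,
    hμ.1, gElt, splitPoint]

theorem gElt_mem_Jideal (ζ : ℕ → F) (i : Fin d) :
    gElt F d θ θs ζ ((i : ℕ) + 1) ∈ Jideal F d θ θs ζ :=
  Submodule.subset_span (Or.inr ⟨_, ⟨by omega, i.isLt⟩, rfl⟩)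

/-- Modulo `J`, the element `μ p` is the scalar multiple of `e*_0` given by evaluating `p` at
the split point. -/
theorem MuProps.sub_eval_smul_mem_Jideal (hμ : MuProps F d θ θs μ) (ζ : ℕ → F)
    (p : MvPolynomial (Fin d) F) :
    μ p - MvPolynomial.eval (splitPoint d θs ζ) p • esT F d θ θs 0 ∈ Jideal F d θ θs ζ := by
  induction p using MvPolynomial.induction_on with
  | C a =>
    rw [← mul_one (MvPolynomial.C a), ← MvPolynomial.smul_eq_C_mul, map_smul, hμ.1]
    simp [MvPolynomial.smul_eval]
  | add p q hp hq =>
    rw [map_add, map_add, add_smul, add_sub_add_comm]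
    exact add_mem hp hq
  | mul_X p i hp =>
    have key : μ (p * MvPolynomial.X i) - MvPolynomial.eval (splitPoint d θs ζ)
          (p * MvPolynomial.X i) • esT F d θ θs 0 =
        μ p • gElt F d θ θs ζ ((i : ℕ) + 1) + splitPoint d θs ζ i •
          (μ p - MvPolynomial.eval (splitPoint d θs ζ) p • esT F d θ θs 0) := by
      rw [← hμ.map_X_sub_C, smul_eq_mul, ← hμ.2.1, mul_sub, map_sub, mul_comm p (MvPolynomial.C _),
        ← MvPolynomial.smul_eq_C_mul, map_smul, smul_sub, smul_smul,
        map_mul (MvPolynomial.eval _),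
        MvPolynomial.eval_X, mul_comm (splitPoint d θs ζ i)]
      abel
    rw [key]
    exact add_mem (Submodule.smul_mem _ _ (gElt_mem_Jideal ζ i))
      (Submodule.smul_of_tower_mem _ _ hp)

/-- Compressing an element of `J` to `e*_0Te*_0` yields the image of a polynomial vanishing at
the split point. -/
theorem MuProps.exists_eval_eq_zero (hμ : MuProps F d θ θs μ) (ζ : ℕ → F)
    {x : TAlg F d θ θs} (hx : x ∈ Jideal F d θ θs ζ) (t : TAlg F d θ θs) :
    ∃ p, MvPolynomial.eval (splitPoint d θs ζ) p = 0 ∧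
      μ p = esT F d θ θs 0 * (t * x) * esT F d θ θs 0 := by
  have he := esT_zero_mul_self d θ θs
  induction hx using Submodule.span_induction generalizing t with
  | mem x hx =>
    obtain rfl | ⟨j, ⟨hj, hjd⟩, rfl⟩ := hx
    · refine ⟨0, map_zero _, ?_⟩
      rw [map_zero, mul_assoc, mul_assoc, sub_mul, he, one_mul, sub_self, mul_zero, mul_zero]
    · obtain ⟨i, rfl⟩ : ∃ i : Fin d, j = (i : ℕ) + 1 :=
        ⟨⟨j - 1, by omega⟩, (Nat.sub_add_cancel hj).symm⟩
      obtain ⟨q, hq⟩ : esT F d θ θs 0 * (t * esT F d θ θs 0) ∈ LinearMap.range μ := by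
        rw [hμ.2.2.2]
        exact ⟨t, rfl⟩
      refine ⟨q * (MvPolynomial.X i - MvPolynomial.C (splitPoint d θs ζ i)), by simp, ?_⟩
      rw [hμ.2.1, hμ.map_X_sub_C, hq]
      simp only [gElt, mul_sub, sub_mul, mul_assoc, he, mul_smul_comm, smul_mul_assoc]
      simp only [← mul_assoc (esT F d θ θs 0) (esT F d θ θs 0), he]
  | zero => exact ⟨0, map_zero _, by simp⟩
  | add x y _ _ hx hy =>
    obtain ⟨p, hp, hp'⟩ := hx t
    obtain ⟨q, hq, hq'⟩ := hy t
    exact ⟨p + q, by rw [map_add, hp, hq, add_zero], by rw [map_add, hp', hq']; noncomm_ring⟩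
  | smul s x _ hx =>
    obtain ⟨p, hp, hp'⟩ := hx (t * s)
    exact ⟨p, hp, by rw [hp', smul_eq_mul, mul_assoc t]⟩

end

/-- If `μ` is an isomorphism then `e*_0Te*_0 = F e*_0 + (e*_0Te*_0 ∩ J)`, a direct sum of
`F`-subspaces. -/
theorem stmt8 {F : Type*} [Field F] (d : ℕ) (θ θs : ℕ → F) (h : EigCond F d θ θs)
    (μ : MvPolynomial (Fin d) F →ₗ[F] TAlg F d θ θs) (hμ : MuProps F d θ θs μ)
    (hinj : Function.Injective μ)
    (ζ : ℕ → F) (hζ : ZetaCond F d θ θs ζ) :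
    corner F d θ θs = Submodule.span F {esT F d θ θs 0} ⊔
      (corner F d θ θs ⊓ (Jideal F d θ θs ζ).restrictScalars F) ∧
    Disjoint (Submodule.span F {esT F d θ θs 0})
      (corner F d θ θs ⊓ (Jideal F d θ θs ζ).restrictScalars F) := by
  have he := esT_zero_mul_self d θ θs
  refine ⟨le_antisymm (fun x hx => ?_) (sup_le ?_ inf_le_left), ?_⟩
  · obtain ⟨p, rfl⟩ : x ∈ LinearMap.range μ := hμ.2.2.2 ▸ hx
    have hmem : ∀ c : F, c • esT F d θ θs 0 ∈ corner F d θ θs := fun c => by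
      rw [← hμ.2.2.2, ← hμ.1, ← map_smul]
      exact LinearMap.mem_range_self _ _
    rw [← add_sub_cancel (MvPolynomial.eval (splitPoint d θs ζ) p • esT F d θ θs 0) (μ p)]
    exact Submodule.add_mem_sup
      (Submodule.smul_mem _ _ (Submodule.mem_span_singleton_self _))
      ⟨sub_mem hx (hmem _), hμ.sub_eval_smul_mem_Jideal ζ p⟩
  · rw [Submodule.span_singleton_le_iff_mem, ← hμ.2.2.2, ← hμ.1]
    exact LinearMap.mem_range_self _ _
  · rw [Submodule.disjoint_def]
    rintro x hx ⟨-, hxJ⟩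
    obtain ⟨c, rfl⟩ := Submodule.mem_span_singleton.1 hx
    obtain ⟨p, hp, hpx⟩ := hμ.exists_eval_eq_zero ζ hxJ 1
    have hpc : p = c • 1 := hinj <| by
      rw [hpx, map_smul, hμ.1, one_mul, mul_smul_comm, smul_mul_assoc, he, he]
    have hc : c = 0 := by simpa [hpc, MvPolynomial.smul_eval] using hp
    rw [hc, zero_smul]
end
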